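/- Let C be a nonzero Weyl candidate on n-dimensional Minkowski vector space with superenergy tensor 𝒯, and let v₁, v₂, v₃, v₄ be future-pointing timelike vectors. Then 𝒯_{αβλμ} v₁^α v₂^β v₃^λ v₄^μ > 0. -/

import Mathlib

open Finset

noncomputable section

/-- Sign of the `i`-th diagonal entry of the Minkowski metric diag(-1,1,...,1). -/
def sgn {n : ℕ} (i : Fin n) : ℝ := if (i : ℕ) = 0 then -1 else 1

/-- The Minkowski metric components η_{ij} (= η^{ij}). -/
def eta {n : ℕ} (i j : Fin n) : ℝ := if i = j then sgn i else 0

/-- Minkowski square η(v,v) of a vector. -/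
def mSq {n : ℕ} (v : Fin n → ℝ) : ℝ := ∑ i, sgn i * v i * v i

/-- Lowered components v_i = η_{ij} v^j. -/
def lo {n : ℕ} (v : Fin n → ℝ) (i : Fin n) : ℝ := sgn i * v i

/-- A Weyl candidate: the index symmetries of the Weyl tensor plus tracelessness. -/
def IsWeyl {n : ℕ} (C : Fin n → Fin n → Fin n → Fin n → ℝ) : Prop :=
  (∀ a b l m, C b a l m = - C a b l m) ∧
  (∀ a b l m, C a b m l = - C a b l m) ∧
  (∀ a b l m, C a b l m = C l m a b) ∧
  (∀ a b l m, C a b l m + C a l m b + C a m b l = 0) ∧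
  (∀ b m, ∑ a, sgn a * C a b a m = 0)

/-- The superenergy (generalized Bel–Robinson) tensor of a Weyl candidate. -/
def SE {n : ℕ} (C : Fin n → Fin n → Fin n → Fin n → ℝ) (a b l m : Fin n) : ℝ :=
  (∑ r, ∑ s, sgn r * sgn s * (C a r l s * C b r m s + C a r m s * C b r l s))
  - (1/2) * eta a b * (∑ r, ∑ t, ∑ s, sgn r * sgn t * sgn s * C r t l s * C r t m s)
  - (1/2) * eta l m * (∑ r, ∑ s, ∑ t, sgn r * sgn s * sgn t * C a r s t * C b r s t)
  + (1/8) * eta a b * eta l m *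
      (∑ r, ∑ t, ∑ s, ∑ v, sgn r * sgn t * sgn s * sgn v * C r t s v * C r t s v)

/-- The polarised energy-momentum tensor of two 2-forms. -/
def emTensor {n : ℕ} (F G : Fin n → Fin n → ℝ) (a b : Fin n) : ℝ :=
  (1/2) * (∑ r, sgn r * (F a r * G b r + G a r * F b r))
  - (1/4) * eta a b * ∑ r, ∑ t, sgn r * sgn t * (F r t * G r t)

/-- The energy form obtained by contracting `emTensor` with two vectors. -/
def emForm {n : ℕ} (u v : Fin n → ℝ) (F G : Fin n → Fin n → ℝ) : ℝ :=
  ∑ a, ∑ b, emTensor F G a b * u a * v b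

lemma sgn_zero {k : ℕ} : sgn (0 : Fin (k + 1)) = -1 := by simp [sgn]

lemma sgn_succ {k : ℕ} (i : Fin k) : sgn i.succ = 1 := by simp [sgn]

lemma sgn_mul_self {n : ℕ} (i : Fin n) : sgn i * sgn i = 1 := by
  unfold sgn; split_ifs <;> norm_num

lemma diagonal_sgn_mul_self {n : ℕ} :
    Matrix.diagonal (sgn (n := n)) * Matrix.diagonal sgn = 1 := by
  simp [Matrix.diagonal_mul_diagonal, sgn_mul_self]

lemma sum_eta_mul {n : ℕ} (u v : Fin n → ℝ) (X : ℝ) :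
    ∑ a, ∑ b, eta a b * X * u a * v b = (∑ a, sgn a * u a * v a) * X := by
  simp only [eta, ite_mul, zero_mul, Finset.sum_ite_eq, Finset.mem_univ, if_true,
    Finset.sum_mul]
  exact Finset.sum_congr rfl fun a _ => by ring

lemma emForm_self {n : ℕ} (u v : Fin n → ℝ) (F : Fin n → Fin n → ℝ) :
    emForm u v F F = (∑ a, ∑ b, (∑ r, sgn r * (F a r * F b r)) * u a * v b)
      - 1/4 * (∑ a, sgn a * u a * v a) * ∑ r, ∑ t, sgn r * sgn t * (F r t * F r t) := by
  have h := sum_eta_mul u v (1/4 * ∑ r, ∑ t, sgn r * sgn t * (F r t * F r t))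
  have : 1/4 * (∑ a, sgn a * u a * v a) * ∑ r, ∑ t, sgn r * sgn t * (F r t * F r t) =
      (∑ a, sgn a * u a * v a) * (1/4 * ∑ r, ∑ t, sgn r * sgn t * (F r t * F r t)) := by ring
  rw [this, ← h]
  simp only [emForm, emTensor, ← Finset.sum_sub_distrib, ← two_mul, ← mul_assoc]
  refine Finset.sum_congr rfl fun a _ => Finset.sum_congr rfl fun b _ => ?_
  have : ∑ r, sgn r * 2 * F a r * F b r = 2 * ∑ r, sgn r * F a r * F b r := by
    rw [Finset.mul_sum]; exact Finset.sum_congr rfl fun r _ => by ring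
  rw [this]; ring

open Matrix in
lemma mul_diagonal_mul_apply {n : ℕ} (A B : Matrix (Fin n) (Fin n) ℝ) (d : Fin n → ℝ)
    (a b : Fin n) : (A * diagonal d * B) a b = ∑ r, A a r * d r * B r b := by
  rw [mul_apply]
  exact Finset.sum_congr rfl fun r _ => by rw [mul_diagonal]

open Matrix in
lemma emForm_self_eq_matrix {n : ℕ} (u v : Fin n → ℝ) (F : Fin n → Fin n → ℝ) :
    emForm u v F F = u ⬝ᵥ (of F * diagonal sgn * (of F)ᵀ) *ᵥ v
      - 1/4 * (u ⬝ᵥ diagonal sgn *ᵥ v) * trace (of F * diagonal sgn * (of F)ᵀ * diagonal sgn) := by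
  rw [emForm_self]
  have h₁ : u ⬝ᵥ (of F * diagonal sgn * (of F)ᵀ) *ᵥ v =
      ∑ a, ∑ b, (∑ r, sgn r * (F a r * F b r)) * u a * v b := by
    simp only [dotProduct, mulVec, mul_diagonal_mul_apply, transpose_apply, of_apply]
    refine Finset.sum_congr rfl fun a _ => ?_
    rw [Finset.mul_sum]
    refine Finset.sum_congr rfl fun b _ => ?_
    have : ∑ r, F a r * sgn r * F b r = ∑ r, sgn r * (F a r * F b r) :=
      Finset.sum_congr rfl fun r _ => by ring
    rw [this]; ring
  have h₂ : u ⬝ᵥ diagonal sgn *ᵥ v = ∑ a, sgn a * u a * v a := by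
    simp only [dotProduct, mulVec_diagonal]
    exact Finset.sum_congr rfl fun a _ => by ring
  have h₃ : trace (of F * diagonal sgn * (of F)ᵀ * diagonal sgn) =
      ∑ r, ∑ t, sgn r * sgn t * (F r t * F r t) := by
    simp only [trace, diag_apply, mul_diagonal _ _, mul_diagonal_mul_apply, transpose_apply, of_apply]
    refine Finset.sum_congr rfl fun r _ => ?_
    rw [Finset.sum_mul]
    exact Finset.sum_congr rfl fun t _ => by ring
  rw [h₁, h₂, h₃]

/-- The energy flux in the rest frame, as a weighted sum of squares of the electric and
magnetic parts. -/
lemma emForm_rest_eq {k : ℕ} (v : Fin (k + 1) → ℝ) (hv : v 0 ≠ 0)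
    (F : Fin (k + 1) → Fin (k + 1) → ℝ) (hF : ∀ a r, F r a = - F a r) :
    emForm (Pi.single 0 1) v F F =
      v 0 / 4 * (∑ i : Fin k, ∑ j : Fin k, (F i.succ j.succ +
        (v i.succ * F 0 j.succ - F 0 i.succ * v j.succ) / v 0) ^ 2)
      + 1 / (2 * v 0) * (-(mSq v) * (∑ i : Fin k, F 0 i.succ ^ 2)
        + (∑ i : Fin k, v i.succ * F 0 i.succ) ^ 2) := by
  have h0 : F 0 0 = 0 := by linarith [hF 0 0]
  have hs : ∀ i : Fin k, F i.succ 0 = - F 0 i.succ := fun i => hF 0 i.succ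
  have hsq : ∀ i j : Fin k, (F i.succ j.succ +
        (v i.succ * F 0 j.succ - F 0 i.succ * v j.succ) / v 0) ^ 2 =
      F i.succ j.succ ^ 2 + 2 / v 0 * (v i.succ * (F i.succ j.succ * F 0 j.succ))
        + 2 / v 0 * (v j.succ * (F j.succ i.succ * F 0 i.succ))
        + 1 / v 0 ^ 2 * (v i.succ ^ 2 * F 0 j.succ ^ 2)
        + 1 / v 0 ^ 2 * (F 0 i.succ ^ 2 * v j.succ ^ 2)
        - 2 / v 0 ^ 2 * ((v i.succ * F 0 i.succ) * (v j.succ * F 0 j.succ)) := by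
    intro i j
    rw [hF i.succ j.succ]
    field_simp
    ring
  have hcomm : ∑ i : Fin k, ∑ j : Fin k, v j.succ * (F j.succ i.succ * F 0 i.succ) =
      ∑ i : Fin k, ∑ j : Fin k, v i.succ * (F i.succ j.succ * F 0 j.succ) :=
    Finset.sum_comm
  simp only [hsq, Finset.sum_add_distrib, Finset.sum_sub_distrib, ← Finset.mul_sum, hcomm,
    ← Finset.sum_mul]
  rw [emForm_self]
  simp only [mSq, Fin.sum_univ_succ, sgn_zero, sgn_succ, h0, hs, Pi.single_eq_same,
    Pi.single_eq_of_ne (Fin.succ_ne_zero _)]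
  simp only [mul_zero, zero_mul, Finset.sum_const_zero, add_zero, zero_add, one_mul, mul_one,
    Finset.sum_add_distrib, neg_mul, mul_neg, neg_neg, Finset.sum_neg_distrib, ← pow_two, neg_zero, one_pow, neg_sq,
    zero_pow two_ne_zero]
  have hY : ∑ i : Fin k, (∑ j : Fin k, F 0 j.succ * F i.succ j.succ) * v i.succ =
      ∑ i : Fin k, v i.succ * ∑ j : Fin k, F i.succ j.succ * F 0 j.succ := by
    refine Finset.sum_congr rfl fun i _ => ?_
    rw [mul_comm]
    congr 1
    exact Finset.sum_congr rfl fun j _ => by ring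
  rw [hY]
  field_simp
  ring

lemma emForm_rest_pos {k : ℕ} (v : Fin (k + 1) → ℝ) (hv : mSq v < 0) (hv0 : 0 < v 0)
    (F : Fin (k + 1) → Fin (k + 1) → ℝ) (hF : ∀ a r, F r a = - F a r) (hF0 : F ≠ 0) :
    0 < emForm (Pi.single 0 1) v F F := by
  rw [emForm_rest_eq v hv0.ne' F hF]
  have hE : 0 ≤ ∑ i : Fin k, F 0 i.succ ^ 2 := Finset.sum_nonneg fun i _ => sq_nonneg _
  have hB : 0 ≤ ∑ i : Fin k, ∑ j : Fin k, (F i.succ j.succ +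
        (v i.succ * F 0 j.succ - F 0 i.succ * v j.succ) / v 0) ^ 2 :=
    Finset.sum_nonneg fun i _ => Finset.sum_nonneg fun j _ => sq_nonneg _
  have hv' : 0 < -(mSq v) := by linarith
  rcases hE.eq_or_lt with h | h
  · have hE0 : ∀ i : Fin k, F 0 i.succ = 0 := fun i => by
      simpa using (Finset.sum_eq_zero_iff_of_nonneg (fun i _ => sq_nonneg _)).1 h.symm i
        (Finset.mem_univ i)
    simp only [hE0, mul_zero, zero_mul, sub_zero, zero_div, add_zero] at hB ⊢
    have : ∃ i j : Fin k, F i.succ j.succ ≠ 0 := by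
      by_contra! hc
      refine hF0 (funext fun a => funext fun b => ?_)
      have h00 : F 0 0 = 0 := by linarith [hF 0 0]
      refine Fin.cases (Fin.cases h00 hE0 b) (fun i => Fin.cases ?_ (hc i) b) a
      rw [hF 0 i.succ, hE0]; simp
    obtain ⟨i, j, hij⟩ := this
    have hpos : 0 < ∑ i : Fin k, ∑ j : Fin k, F i.succ j.succ ^ 2 :=
      Finset.sum_pos' (fun i _ => Finset.sum_nonneg fun j _ => sq_nonneg _)
        ⟨i, Finset.mem_univ i, Finset.sum_pos' (fun j _ => sq_nonneg _)
          ⟨j, Finset.mem_univ j, by positivity⟩⟩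
    simp only [Finset.sum_const_zero]
    positivity
  · positivity

lemma sum_sgn_mul_neg {k : ℕ} {u v : Fin (k + 1) → ℝ} (hu : mSq u < 0) (hu0 : 0 < u 0)
    (hv : mSq v < 0) (hv0 : 0 < v 0) : ∑ a, sgn a * u a * v a < 0 := by
  simp only [mSq, Fin.sum_univ_succ, sgn_zero, sgn_succ, one_mul] at hu hv ⊢
  have h := Finset.sum_mul_sq_le_sq_mul_sq Finset.univ (fun i : Fin k => u i.succ)
    (fun i => v i.succ)
  simp only [pow_two (u _), pow_two (v _)] at h
  have hA : 0 ≤ ∑ i : Fin k, u i.succ * u i.succ :=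
    Finset.sum_nonneg fun i _ => mul_self_nonneg _
  have hB : 0 ≤ ∑ i : Fin k, v i.succ * v i.succ :=
    Finset.sum_nonneg fun i _ => mul_self_nonneg _
  have : (∑ i : Fin k, u i.succ * v i.succ) ^ 2 < (u 0 * v 0) ^ 2 := by
    nlinarith [mul_pos hu0 hu0, mul_pos hv0 hv0]
  linarith [lt_of_pow_lt_pow_left₀ 2 (by positivity) this]

open Matrix in
/-- Minus a reflection: a Lorentz transformation carrying the time axis to a given timelike
direction. -/
lemma exists_lorentz {k : ℕ} {u : Fin (k + 1) → ℝ} (hu : mSq u < 0) (hu0 : 0 < u 0) :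
    ∃ (L : Matrix (Fin (k + 1)) (Fin (k + 1)) ℝ) (s : ℝ), 0 < s ∧
      L * diagonal sgn * Lᵀ = diagonal sgn ∧ s • (L *ᵥ Pi.single 0 1) = u := by
  set s := √(-(mSq u)) with hs
  have hs0 : 0 < s := Real.sqrt_pos.2 (by linarith)
  have hss : s * s = -(mSq u) := Real.mul_self_sqrt (by linarith)
  set w : Fin (k + 1) → ℝ := u + s • Pi.single 0 1 with hw
  set c := s * (s + u 0) with hc
  have hc0 : 0 < c := by positivity
  have hww : ∑ a, sgn a * w a * w a = -2 * c := by
    have : ∑ a, sgn a * w a * w a = mSq u - 2 * s * u 0 - s * s := by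
      simp only [mSq, hw, Fin.sum_univ_succ, sgn_zero, sgn_succ]
      simp
      ring
    rw [this, hc]; linarith
  refine ⟨-1 - c⁻¹ • vecMulVec w (fun b => sgn b * w b), s, hs0, ?_, ?_⟩
  · ext a b
    simp only [mul_diagonal_mul_apply, transpose_apply, Matrix.sub_apply, Matrix.neg_apply, Matrix.smul_apply,
      vecMulVec_apply, smul_eq_mul]
    have : ∀ r, (-(1 : Matrix (Fin (k + 1)) (Fin (k + 1)) ℝ) a r - c⁻¹ * (w a * (sgn r * w r)))
        * sgn r * (-(1 : Matrix (Fin (k + 1)) (Fin (k + 1)) ℝ) b r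
          - c⁻¹ * (w b * (sgn r * w r))) =
        (1 : Matrix (Fin (k + 1)) (Fin (k + 1)) ℝ) a r *
          ((1 : Matrix (Fin (k + 1)) (Fin (k + 1)) ℝ) b r * sgn r)
        + (1 : Matrix (Fin (k + 1)) (Fin (k + 1)) ℝ) a r * (c⁻¹ * w b * w r)
        + (1 : Matrix (Fin (k + 1)) (Fin (k + 1)) ℝ) b r * (c⁻¹ * w a * w r)
        + (c⁻¹ * c⁻¹ * w a * w b) * (sgn r * w r * w r) := by
      intro r
      linear_combination
        ((1 : Matrix (Fin (k + 1)) (Fin (k + 1)) ℝ) a r * (c⁻¹ * w b * w r)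
        + (1 : Matrix (Fin (k + 1)) (Fin (k + 1)) ℝ) b r * (c⁻¹ * w a * w r)
        + (c⁻¹ * c⁻¹ * w a * w b) * (sgn r * w r * w r)) * sgn_mul_self r
    simp only [this, Finset.sum_add_distrib, ← Finset.mul_sum, hww]
    simp only [one_apply, ite_mul, one_mul, zero_mul, Finset.sum_ite_eq, Finset.mem_univ,
      if_true, diagonal_apply]
    have hcc : c⁻¹ * c = 1 := inv_mul_cancel₀ hc0.ne'
    have h : (if b = a then sgn a else 0) = if a = b then sgn a else 0 := by
      simp only [eq_comm]
    rw [h]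
    linear_combination (-2 * c⁻¹ * w a * w b) * hcc
  · ext a
    simp only [mulVec_single_one, Pi.smul_apply, smul_eq_mul, col_apply, Matrix.sub_apply, Matrix.neg_apply,
      Matrix.smul_apply, vecMulVec_apply, sgn_zero]
    have h0 : w 0 = s + u 0 := by simp [hw]; ring
    have ha : w a = u a + s * (1 : Matrix (Fin (k + 1)) (Fin (k + 1)) ℝ) a 0 := by
      simp [hw, one_apply, Pi.single_apply]
    have hcs : c⁻¹ * (s * (s + u 0)) = 1 := inv_mul_cancel₀ hc0.ne'
    rw [h0]
    linear_combination w a * hcs + ha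

open Matrix in
lemma emForm_pos {k : ℕ} {u v : Fin (k + 1) → ℝ} (hu : mSq u < 0) (hu0 : 0 < u 0)
    (hv : mSq v < 0) (hv0 : 0 < v 0)
    (F : Fin (k + 1) → Fin (k + 1) → ℝ) (hF : ∀ a r, F r a = - F a r) (hF0 : F ≠ 0) :
    0 < emForm u v F F := by
  obtain ⟨L, s, hs, hL, hLu⟩ := exists_lorentz hu hu0
  have hDD := diagonal_sgn_mul_self (n := k + 1)
  set D : Matrix (Fin (k + 1)) (Fin (k + 1)) ℝ := diagonal sgn with hD
  have hinv : L * (D * Lᵀ * D) = 1 := by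
    rw [← hDD, ← Matrix.mul_assoc, ← Matrix.mul_assoc, hL]
  have hinv' : D * Lᵀ * D * L = 1 := mul_eq_one_comm.1 hinv
  have hL' : Lᵀ * D * L = D := by
    calc Lᵀ * D * L = D * D * (Lᵀ * D * L) := by rw [hDD, Matrix.one_mul]
      _ = D * (D * Lᵀ * D * L) := by simp only [Matrix.mul_assoc]
      _ = D := by rw [hinv', Matrix.mul_one]
  set x := (D * Lᵀ * D) *ᵥ v with hx
  set e : Fin (k + 1) → ℝ := Pi.single 0 1 with he
  have hLx : L *ᵥ x = v := by rw [hx, mulVec_mulVec, hinv, one_mulVec]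
  have hdot : ∀ y z : Fin (k + 1) → ℝ, y ⬝ᵥ D *ᵥ z = ∑ a, sgn a * y a * z a := by
    intro y z
    simp only [hD, dotProduct, mulVec_diagonal]
    exact Finset.sum_congr rfl fun a _ => by ring
  have hmul : ∀ (A : Matrix (Fin (k + 1)) (Fin (k + 1)) ℝ) (y z : Fin (k + 1) → ℝ),
      (L *ᵥ y) ⬝ᵥ A *ᵥ (L *ᵥ z) = y ⬝ᵥ (Lᵀ * A * L) *ᵥ z := by
    intro A y z
    rw [← vecMul_transpose, ← dotProduct_mulVec, mulVec_mulVec, mulVec_mulVec, Matrix.mul_assoc]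
  have hxv : mSq x = mSq v := by
    rw [mSq, ← hdot, mSq, ← hdot, ← hLx, hmul, hL']
  have hx0 : 0 < x 0 := by
    have h₁ : e ⬝ᵥ D *ᵥ x = - x 0 := by
      simp [he, hD, mulVec_diagonal, sgn_zero]
    have h₂ : s * (e ⬝ᵥ D *ᵥ x) < 0 := by
      rw [← hL', ← hmul, hLx, ← smul_eq_mul, ← smul_dotProduct, hLu, hdot]
      exact sum_sgn_mul_neg hu hu0 hv hv0
    nlinarith
  set G : Matrix (Fin (k + 1)) (Fin (k + 1)) ℝ := Lᵀ * of F * L with hG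
  have hFT : (of F)ᵀ = - of F := by ext a r; exact hF a r
  have hGT : Gᵀ = -G := by
    simp only [hG, transpose_mul, transpose_transpose, hFT, Matrix.mul_neg, Matrix.neg_mul,
      Matrix.mul_assoc]
  have hG0 : G ≠ 0 := by
    intro h
    have h' : D * L * D * G * (D * Lᵀ * D) = of F := by
      have : D * L * D * Lᵀ = 1 := by rw [Matrix.mul_assoc D, Matrix.mul_assoc D, hL, hDD]
      calc D * L * D * G * (D * Lᵀ * D) = (D * L * D * Lᵀ) * of F * (L * (D * Lᵀ * D)) := by
            simp only [hG, Matrix.mul_assoc]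
        _ = of F := by rw [this, hinv, Matrix.one_mul, Matrix.mul_one]
    rw [h, Matrix.mul_zero, Matrix.zero_mul] at h'
    exact hF0 (funext fun a => funext fun b => (congrFun (congrFun h' a) b).symm)
  have hpos := emForm_rest_pos x (hxv ▸ hv) hx0 (of.symm G)
    (fun a r => congrFun (congrFun hGT a) r) (fun h => hG0 h)
  have key : emForm u v F F = s * emForm e x (of.symm G) (of.symm G) := by
    rw [emForm_self_eq_matrix, emForm_self_eq_matrix, Equiv.apply_symm_apply, ← hD, ← hLu, ← hLx]
    simp only [smul_dotProduct, hmul, hL', smul_eq_mul]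
    have h₁ : Lᵀ * (of F * D * (of F)ᵀ) * L = G * D * Gᵀ := by
      have : G * D * Gᵀ = Lᵀ * (of F * (L * D * Lᵀ) * (of F)ᵀ) * L := by
        simp only [hG, transpose_mul, transpose_transpose, Matrix.mul_assoc]
      rw [this, hL]
    have h₂ : trace (G * D * Gᵀ * D) = trace (of F * D * (of F)ᵀ * D) := by
      rw [← h₁, Matrix.mul_assoc, Matrix.mul_assoc, trace_mul_comm]
      congr 1
      rw [Matrix.mul_assoc, hL]
    rw [h₁, h₂]
    ring
  rw [key]
  exact mul_pos hs hpos

/-- The linear map on 4-index arrays through which `emForm` factors. -/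
def emContract {n : ℕ} (u v : Fin n → ℝ) :
    (Fin n → Fin n → Fin n → Fin n → ℝ) →ₗ[ℝ] ℝ where
  toFun P := ∑ a, ∑ b, ((1/2) * (∑ r, sgn r * (P a r b r + P b r a r))
    - (1/4) * eta a b * ∑ r, ∑ t, sgn r * sgn t * P r t r t) * u a * v b
  map_add' P Q := by
    simp only [← Finset.sum_add_distrib]
    refine Finset.sum_congr rfl fun a _ => Finset.sum_congr rfl fun b _ => ?_
    simp only [Pi.add_apply, mul_add, Finset.sum_add_distrib]
    ring
  map_smul' c P := by
    simp only [Finset.mul_sum, RingHom.id_apply, smul_eq_mul]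
    refine Finset.sum_congr rfl fun a _ => Finset.sum_congr rfl fun b _ => ?_
    simp only [Pi.smul_apply, smul_eq_mul, ← mul_add, mul_left_comm _ c, ← Finset.mul_sum]
    ring

lemma emContract_tensor {n : ℕ} (u v : Fin n → ℝ) (F G : Fin n → Fin n → ℝ) :
    emContract u v (fun a r b t => F a r * G b t) = emForm u v F G := by
  simp only [emContract, emForm, emTensor, LinearMap.coe_mk, AddHom.coe_mk, mul_comm]

/-- The space of 2-forms. -/
def twoForms (n : ℕ) : Submodule ℝ (Fin n → Fin n → ℝ) where
  carrier := {F | ∀ a r, F r a = - F a r}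
  zero_mem' := by simp
  add_mem' {F G} hF hG a r := by
    simp only [Pi.add_apply, hF a r, hG a r]; ring
  smul_mem' c F hF a r := by
    simp only [Pi.smul_apply, hF a r, smul_neg]

/-- `emForm` as a bilinear form on 2-forms. -/
def emBilin {n : ℕ} (u v : Fin n → ℝ) : LinearMap.BilinForm ℝ (twoForms n) :=
  LinearMap.mk₂ ℝ (fun F G => emForm u v F G)
    (fun F F' G => by
      simp only [← emContract_tensor, ← map_add]
      congr 1; funext a r b t
      simp [add_mul])
    (fun c F G => by
      simp only [← emContract_tensor, ← map_smul]
      congr 1; funext a r b t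
      simp [mul_assoc])
    (fun F G G' => by
      simp only [← emContract_tensor, ← map_add]
      congr 1; funext a r b t
      simp [mul_add])
    (fun c F G => by
      simp only [← emContract_tensor, ← map_smul]
      congr 1; funext a r b t
      simp [mul_left_comm])

lemma emBilin_isSymm {n : ℕ} (u v : Fin n → ℝ) : LinearMap.IsSymm (emBilin u v) :=
  ⟨fun F G => by
    change emForm u v F G = emForm u v G F
    simp only [emForm, emTensor, mul_comm, add_comm]⟩

/-- Diagonalisation of the energy form by linear functionals on 2-forms. -/
lemma exists_emForm_eq_sum {k : ℕ} {u v : Fin (k + 1) → ℝ} (hu : mSq u < 0) (hu0 : 0 < u 0)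
    (hv : mSq v < 0) (hv0 : 0 < v 0) :
    ∃ (N : ℕ) (d : Fin N → ℝ) (x : Fin N → twoForms (k + 1) →ₗ[ℝ] ℝ), (∀ i, 0 < d i) ∧
      (∀ F, (∀ i, x i F = 0) → F = 0) ∧
      ∀ F G : twoForms (k + 1), emForm u v F G = ∑ i, d i * (x i F * x i G) := by
  obtain ⟨b, hb⟩ := LinearMap.BilinForm.exists_orthogonal_basis (B := emBilin u v)
    (emBilin_isSymm u v)
  refine ⟨_, fun i => emBilin u v (b i) (b i), fun i => b.coord i, fun i => ?_,
    fun F h => b.ext_elem fun i => by simpa using h i, fun F G => ?_⟩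
  · exact emForm_pos hu hu0 hv hv0 _ (b i).2 fun h => b.ne_zero i (Subtype.ext h)
  · change emBilin u v F G = _
    conv_lhs => rw [← b.sum_repr F, ← b.sum_repr G]
    simp only [map_sum, LinearMap.sum_apply, map_smul, LinearMap.smul_apply, smul_eq_mul,
      Finset.mul_sum]
    refine Finset.sum_congr rfl fun i _ => ?_
    rw [Finset.sum_eq_single i]
    · simp only [Module.Basis.coord_apply]; ring
    · intro j _ hj
      rw [show emBilin u v (b j) (b i) = 0 from hb hj]; simp
    · simp

lemma SE_eq {n : ℕ} (C : Fin n → Fin n → Fin n → Fin n → ℝ) (a b l m : Fin n) :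
    SE C a b l m = 2 * ((1/2) * (∑ s, sgn s *
        (emTensor (fun i j => C i j l s) (fun i j => C i j m s) a b
          + emTensor (fun i j => C i j m s) (fun i j => C i j l s) a b))
      - (1/4) * eta l m * ∑ t, ∑ s, sgn t * sgn s *
        emTensor (fun i j => C i j t s) (fun i j => C i j t s) a b) := by
  have h₁ : ∑ r, ∑ s, sgn r * sgn s * (C a r l s * C b r m s + C a r m s * C b r l s) =
      ∑ s, sgn s * ∑ r, sgn r * (C a r l s * C b r m s + C a r m s * C b r l s) := by
    rw [Finset.sum_comm]
    simp only [Finset.mul_sum]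
    exact Finset.sum_congr rfl fun s _ => Finset.sum_congr rfl fun r _ => by ring
  have h₂ : ∑ r, ∑ t, ∑ s, sgn r * sgn t * sgn s * C r t l s * C r t m s =
      ∑ s, sgn s * ∑ r, ∑ t, sgn r * sgn t * (C r t l s * C r t m s) := by
    simp only [Finset.mul_sum]
    rw [Finset.sum_comm_cycle]
    exact Finset.sum_congr rfl fun s _ => Finset.sum_congr rfl fun r _ =>
      Finset.sum_congr rfl fun t _ => by ring
  have h₃ : ∑ r, ∑ s, ∑ t, sgn r * sgn s * sgn t * C a r s t * C b r s t =
      ∑ t, ∑ s, sgn t * sgn s * ∑ r, sgn r * (C a r t s * C b r t s) := by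
    simp only [Finset.mul_sum]
    rw [← Finset.sum_comm_cycle]
    exact Finset.sum_congr rfl fun r _ => Finset.sum_congr rfl fun t _ =>
      Finset.sum_congr rfl fun s _ => by ring
  have h₄ : ∑ r, ∑ t, ∑ s, ∑ v, sgn r * sgn t * sgn s * sgn v * C r t s v * C r t s v =
      ∑ t, ∑ s, sgn t * sgn s * ∑ r, ∑ v, sgn r * sgn v * (C r v t s * C r v t s) := by
    simp only [Finset.mul_sum]
    symm
    refine (Finset.sum_congr rfl fun _ _ => Finset.sum_comm).trans
      (Finset.sum_comm.trans (Finset.sum_congr rfl fun r _ => Finset.sum_comm_cycle.trans ?_))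
    exact Finset.sum_congr rfl fun t _ => Finset.sum_congr rfl fun s _ =>
      Finset.sum_congr rfl fun v _ => by ring
  have h₅ : ∑ s, sgn s * (emTensor (fun i j => C i j l s) (fun i j => C i j m s) a b
          + emTensor (fun i j => C i j m s) (fun i j => C i j l s) a b) =
      (∑ s, sgn s * ∑ r, sgn r * (C a r l s * C b r m s + C a r m s * C b r l s))
        - 1/2 * eta a b *
          ∑ s, sgn s * ∑ r, ∑ t, sgn r * sgn t * (C r t l s * C r t m s) := by
    rw [Finset.mul_sum, ← Finset.sum_sub_distrib]
    refine Finset.sum_congr rfl fun s _ => ?_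
    have h : ∑ r, sgn r * (C a r m s * C b r l s + C a r l s * C b r m s) =
        ∑ r, sgn r * (C a r l s * C b r m s + C a r m s * C b r l s) := by
      simp only [add_comm]
    have h' : ∑ r, ∑ t, sgn r * sgn t * (C r t m s * C r t l s) =
        ∑ r, ∑ t, sgn r * sgn t * (C r t l s * C r t m s) := by
      simp only [mul_comm (C _ _ m s)]
    simp only [emTensor]
    rw [h, h']
    ring
  have h₆ : ∑ t, ∑ s, sgn t * sgn s *
        emTensor (fun i j => C i j t s) (fun i j => C i j t s) a b =
      (∑ t, ∑ s, sgn t * sgn s * ∑ r, sgn r * (C a r t s * C b r t s))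
        - 1/4 * eta a b *
          ∑ t, ∑ s, sgn t * sgn s * ∑ r, ∑ v, sgn r * sgn v * (C r v t s * C r v t s) := by
    rw [Finset.mul_sum, ← Finset.sum_sub_distrib]
    refine Finset.sum_congr rfl fun t _ => ?_
    rw [Finset.mul_sum, ← Finset.sum_sub_distrib]
    refine Finset.sum_congr rfl fun s _ => ?_
    have h : ∑ r, sgn r * (C a r t s * C b r t s + C a r t s * C b r t s) =
        2 * ∑ r, sgn r * (C a r t s * C b r t s) := by
      rw [Finset.mul_sum]
      exact Finset.sum_congr rfl fun r _ => by ring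
    simp only [emTensor]
    rw [h]
    ring
  rw [SE, h₁, h₂, h₃, h₄, h₅, h₆]
  ring

lemma sum_SE_eq {n : ℕ} (C : Fin n → Fin n → Fin n → Fin n → ℝ) (u v w z : Fin n → ℝ) :
    ∑ a, ∑ b, ∑ l, ∑ m, SE C a b l m * u a * v b * w l * z m =
      2 * emContract w z (fun l s m t =>
        emForm u v (fun i j => C i j l s) (fun i j => C i j m t)) := by
  have h : (fun l s m t => emForm u v (fun i j => C i j l s) (fun i j => C i j m t)) =
      ∑ a, ∑ b, (u a * v b) • fun l s m t =>
        emTensor (fun i j => C i j l s) (fun i j => C i j m t) a b := by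
    funext l s m t
    simp only [Finset.sum_apply, Pi.smul_apply, smul_eq_mul, emForm]
    exact Finset.sum_congr rfl fun a _ => Finset.sum_congr rfl fun b _ => by ring
  rw [h]
  simp only [map_sum, map_smul, smul_eq_mul, Finset.mul_sum]
  refine Finset.sum_congr rfl fun a _ => Finset.sum_congr rfl fun b _ => ?_
  simp only [emContract, LinearMap.coe_mk, AddHom.coe_mk]
  rw [Finset.mul_sum, Finset.mul_sum]
  refine Finset.sum_congr rfl fun l _ => ?_
  rw [Finset.mul_sum, Finset.mul_sum]
  refine Finset.sum_congr rfl fun m _ => ?_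
  rw [SE_eq]
  ring

/-- for a nonzero Weyl candidate, the full contraction of the
superenergy tensor with four future-pointing timelike vectors is strictly positive. -/
theorem stmt_8 {n : ℕ} (hn : 2 ≤ n) (C : Fin n → Fin n → Fin n → Fin n → ℝ)
    (hC : IsWeyl C) (hC0 : C ≠ 0)
    (v₁ v₂ v₃ v₄ : Fin n → ℝ)
    (h₁ : mSq v₁ < 0 ∧ 0 < v₁ ⟨0, by omega⟩)
    (h₂ : mSq v₂ < 0 ∧ 0 < v₂ ⟨0, by omega⟩)
    (h₃ : mSq v₃ < 0 ∧ 0 < v₃ ⟨0, by omega⟩)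
    (h₄ : mSq v₄ < 0 ∧ 0 < v₄ ⟨0, by omega⟩) :
    0 < ∑ a, ∑ b, ∑ l, ∑ m, SE C a b l m * v₁ a * v₂ b * v₃ l * v₄ m := by
  obtain ⟨k, rfl⟩ : ∃ k, n = k + 1 := ⟨n - 1, by omega⟩
  obtain ⟨hC₁, hC₂, -, -, -⟩ := hC
  obtain ⟨N, d, x, hd, hx, hsum⟩ := exists_emForm_eq_sum h₁.1 h₁.2 h₂.1 h₂.2
  let P (l s : Fin (k + 1)) : twoForms (k + 1) := ⟨fun i j => C i j l s, fun a r => hC₁ a r l s⟩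
  have hP : ∀ l s, P s l = - P l s := fun l s => by
    ext i j; exact hC₂ i j l s
  have hdec : (fun l s m t => emForm v₁ v₂ (fun i j => C i j l s) (fun i j => C i j m t)) =
      ∑ i, d i • fun l s m t => x i (P l s) * x i (P m t) := by
    funext l s m t
    simp only [Finset.sum_apply, Pi.smul_apply, smul_eq_mul]
    exact hsum (P l s) (P m t)
  rw [sum_SE_eq, hdec]
  simp only [map_sum, map_smul, smul_eq_mul]
  simp only [fun i => emContract_tensor v₃ v₄ (fun l s => x i (P l s)) (fun l s => x i (P l s))]
  have hskew : ∀ i l s, x i (P s l) = - x i (P l s) := fun i l s => by rw [hP l s, map_neg]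
  have hpos : ∀ i, (fun l s => x i (P l s)) ≠ 0 →
      0 < emForm v₃ v₄ (fun l s => x i (P l s)) (fun l s => x i (P l s)) := fun i hi =>
    emForm_pos h₃.1 h₃.2 h₄.1 h₄.2 _ (hskew i) hi
  have hnonneg : ∀ i, 0 ≤ emForm v₃ v₄ (fun l s => x i (P l s)) (fun l s => x i (P l s)) := by
    intro i
    by_cases hi : (fun l s => x i (P l s)) = 0
    · rw [hi]; simp [emForm, emTensor]
    · exact (hpos i hi).le
  have hex : ∃ i, (fun l s => x i (P l s)) ≠ 0 := by
    by_contra! hc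
    refine hC0 (funext fun a => funext fun b => funext fun l => funext fun s => ?_)
    have := hx (P l s) fun i => congrFun (congrFun (hc i) l) s
    exact congrFun (congrFun (congrArg Subtype.val this) a) b
  obtain ⟨i, hi⟩ := hex
  refine mul_pos two_pos (Finset.sum_pos' (fun i _ => mul_nonneg (hd i).le (hnonneg i))
    ⟨i, Finset.mem_univ i, mul_pos (hd i) (hpos i hi)⟩)
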